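/- Let K, N be positive integers and let R̂ ∈ ℝ^{KN×KN} be symmetric positive definite. A collection Ŵ = (Ŵ^{[k]})_{1≤k≤K} of invertible N×N real matrices is a global minimizer of J̃_IVA-G over all collections of invertible N×N real matrices if and only if the pair (Ŵ, Ĉ(Ŵ)), where Ĉ_n(Ŵ_n) = (Ŵ_n R̂ Ŵ_nᵀ)⁻¹ for every n, is a global minimizer of J_IVA-G over all pairs (W,C) with every W^{[k]} invertible and every C_n symmetric positive definite. -/

import Mathlib

open Matrix

/-- `blockRow W n` is the K×(K·N) block matrix `W_n` whose k-th row carries the n-th row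
of `W^{[k]}` in the k-th block of columns (columns are indexed by `Fin K × Fin N`). -/
def blockRow {K N : ℕ} (W : Fin K → Matrix (Fin N) (Fin N) ℝ) (n : Fin N) :
    Matrix (Fin K) (Fin K × Fin N) ℝ :=
  Matrix.of fun k p => if p.1 = k then W k n p.2 else 0

/-- The IVA-G cost
`J(W,C) = (1/2)·Σₙ [tr(Cₙ Wₙ R̂ Wₙᵀ) − log det Cₙ] − Σₖ log|det W^{[k]}|`. -/
noncomputable def JIVAG {K N : ℕ} (R : Matrix (Fin K × Fin N) (Fin K × Fin N) ℝ)
    (W : Fin K → Matrix (Fin N) (Fin N) ℝ) (C : Fin N → Matrix (Fin K) (Fin K) ℝ) : ℝ :=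
  (1/2) * ∑ n, ((C n * blockRow W n * R * (blockRow W n)ᵀ).trace - Real.log (C n).det)
    - ∑ k, Real.log |(W k).det|

/-- The reduced cost
`J̃(W) = (1/2)·Σₙ log det(Wₙ R̂ Wₙᵀ) − Σₖ log|det W^{[k]}|`. -/
noncomputable def JtIVAG {K N : ℕ} (R : Matrix (Fin K × Fin N) (Fin K × Fin N) ℝ)
    (W : Fin K → Matrix (Fin N) (Fin N) ℝ) : ℝ :=
  (1/2) * ∑ n, Real.log (blockRow W n * R * (blockRow W n)ᵀ).det
    - ∑ k, Real.log |(W k).det|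

/-- The rows of `blockRow W n` are linearly independent when every `W k` is invertible. -/
theorem blockRow_vecMul_injective {K N : ℕ} {W : Fin K → Matrix (Fin N) (Fin N) ℝ}
    (hW : ∀ k, IsUnit (W k).det) (n : Fin N) :
    Function.Injective (blockRow W n).vecMul := by
  have hrow (k : Fin K) : ∃ j, W k n j ≠ 0 := by
    by_contra! h
    exact (hW k).ne_zero (det_eq_zero_of_row_eq_zero n h)
  intro x y hxy
  funext k
  obtain ⟨j, hj⟩ := hrow k
  have h := congrFun hxy (k, j)
  simp only [vecMul, dotProduct, blockRow, of_apply, mul_ite, mul_zero, Finset.sum_ite_eq,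
    Finset.mem_univ, if_true] at h
  exact mul_right_cancel₀ hj h

theorem posDef_blockRow_mul {K N : ℕ} {R : Matrix (Fin K × Fin N) (Fin K × Fin N) ℝ}
    (hR : R.PosDef) {W : Fin K → Matrix (Fin N) (Fin N) ℝ}
    (hW : ∀ k, IsUnit (W k).det) (n : Fin N) :
    (blockRow W n * R * (blockRow W n)ᵀ).PosDef := by
  simpa only [conjTranspose_eq_transpose_of_trivial] using
    hR.mul_mul_conjTranspose_same (blockRow_vecMul_injective hW n)

theorem Matrix.PosDef.card_le_trace_sub_log_det {ι : Type*} [Fintype ι] [DecidableEq ι]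
    {M : Matrix ι ι ℝ} (hM : M.PosDef) :
    (Fintype.card ι : ℝ) ≤ M.trace - Real.log M.det := by
  rw [hM.isHermitian.trace_eq_sum_eigenvalues, hM.isHermitian.det_eq_prod_eigenvalues]
  simp only [RCLike.ofReal_real_eq_id, id_eq]
  rw [Real.log_prod fun i _ => (hM.eigenvalues_pos i).ne', ← Finset.sum_sub_distrib]
  calc (Fintype.card ι : ℝ) = ∑ _i : ι, (1 : ℝ) := by simp
    _ ≤ _ := Finset.sum_le_sum fun i _ => by
      linarith [Real.log_le_sub_one_of_pos (hM.eigenvalues_pos i)]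

open scoped MatrixOrder Matrix.Norms.L2Operator in
/-- Gibbs' inequality for centred Gaussians. -/
theorem Matrix.PosDef.card_add_log_det_le {ι : Type*} [Fintype ι] [DecidableEq ι]
    {A C : Matrix ι ι ℝ} (hA : A.PosDef) (hC : C.PosDef) :
    Fintype.card ι + Real.log A.det ≤ (C * A).trace - Real.log C.det := by
  have hdet := hA.det_pos.ne'
  obtain ⟨B, rfl⟩ := CStarAlgebra.nonneg_iff_eq_star_mul_self.mp hA.posSemidef.nonneg
  have hB : B.det ≠ 0 := fun h => hdet (by simp [h])
  have hM : (B * C * Bᴴ).PosDef := hC.mul_mul_conjTranspose_same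
    (vecMul_injective_iff_isUnit.mpr ((isUnit_iff_isUnit_det B).mpr hB.isUnit))
  have h := hM.card_le_trace_sub_log_det
  have htr : (B * C * Bᴴ).trace = (C * (star B * B)).trace := by
    rw [mul_assoc, trace_mul_comm, mul_assoc, star_eq_conjTranspose]
  have hlog : Real.log (B * C * Bᴴ).det = Real.log C.det + Real.log (star B * B).det := by
    rw [← Real.log_mul hC.det_pos.ne' hdet, star_eq_conjTranspose]
    simp only [det_mul]
    ring_nf
  linarith

/-- Minimising out the precision matrices costs exactly the constant `K N / 2`. -/
theorem JIVAG_inv_eq {K N : ℕ} {R : Matrix (Fin K × Fin N) (Fin K × Fin N) ℝ}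
    (hR : R.PosDef) {W : Fin K → Matrix (Fin N) (Fin N) ℝ} (hW : ∀ k, IsUnit (W k).det) :
    JIVAG R W (fun n => (blockRow W n * R * (blockRow W n)ᵀ)⁻¹) = JtIVAG R W + N * K / 2 := by
  have h (n : Fin N) :
      ((blockRow W n * R * (blockRow W n)ᵀ)⁻¹ * blockRow W n * R * (blockRow W n)ᵀ).trace
        - Real.log (blockRow W n * R * (blockRow W n)ᵀ)⁻¹.det
      = K + Real.log (blockRow W n * R * (blockRow W n)ᵀ).det := by
    have hu := (posDef_blockRow_mul hR hW n).det_pos.ne'.isUnit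
    rw [Matrix.mul_assoc _ (blockRow W n) R, Matrix.mul_assoc _ (blockRow W n * R),
      nonsing_inv_mul _ hu, det_nonsing_inv, Ring.inverse_eq_inv', Real.log_inv]
    simp
  simp only [JIVAG, JtIVAG, h, Finset.sum_add_distrib, Finset.sum_const, Finset.card_univ,
    Fintype.card_fin, nsmul_eq_mul]
  ring

theorem JtIVAG_add_le_JIVAG {K N : ℕ} {R : Matrix (Fin K × Fin N) (Fin K × Fin N) ℝ}
    (hR : R.PosDef) {W : Fin K → Matrix (Fin N) (Fin N) ℝ} (hW : ∀ k, IsUnit (W k).det)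
    {C : Fin N → Matrix (Fin K) (Fin K) ℝ} (hC : ∀ n, (C n).PosDef) :
    JtIVAG R W + N * K / 2 ≤ JIVAG R W C := by
  have h := Finset.sum_le_sum fun n (_ : n ∈ Finset.univ) =>
    (posDef_blockRow_mul hR hW n).card_add_log_det_le (hC n)
  simp only [Finset.sum_add_distrib, Finset.sum_const, Finset.card_univ,
    Fintype.card_fin, nsmul_eq_mul, ← Matrix.mul_assoc] at h
  simp only [JIVAG, JtIVAG]
  linarith

/-- `Ŵ` (with all blocks invertible) is a global minimizer of `J̃_IVA-G` over
collections of invertible matrices iff the pair `(Ŵ, Ĉ(Ŵ))`, with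
`Ĉₙ(Ŵₙ) = (Ŵₙ R̂ Ŵₙᵀ)⁻¹`, is a global minimizer of `J_IVA-G` over all pairs `(W,C)` with
every `W^{[k]}` invertible and every `Cₙ` symmetric positive definite. -/
theorem stmt3 (K N : ℕ) (hK : 0 < K) (hN : 0 < N)
    (R : Matrix (Fin K × Fin N) (Fin K × Fin N) ℝ) (hR : R.PosDef)
    (What : Fin K → Matrix (Fin N) (Fin N) ℝ) (hWhat : ∀ k, IsUnit (What k).det) :
    (∀ W : Fin K → Matrix (Fin N) (Fin N) ℝ, (∀ k, IsUnit (W k).det) →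
        JtIVAG R What ≤ JtIVAG R W) ↔
    (∀ (W : Fin K → Matrix (Fin N) (Fin N) ℝ) (C : Fin N → Matrix (Fin K) (Fin K) ℝ),
        (∀ k, IsUnit (W k).det) → (∀ n, (C n).PosDef) →
        JIVAG R What (fun n => (blockRow What n * R * (blockRow What n)ᵀ)⁻¹) ≤
          JIVAG R W C) := by
  constructor
  · intro h W C hW hC
    rw [JIVAG_inv_eq hR hWhat]
    linarith [h W hW, JtIVAG_add_le_JIVAG hR hW hC]
  · intro h W hW
    have := h W _ hW fun n => (posDef_blockRow_mul hR hW n).inv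
    rw [JIVAG_inv_eq hR hWhat, JIVAG_inv_eq hR hW] at this
    linarith
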